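/- arXiv:1004.0400 — 2 statements merged into one kernel-verified Lean document; each statement's English description precedes it below -/
import Mathlib

section
/- For every d ∈ [0,1] and all integers n ≥ 1 and h ≥ 1, one has h·n·C_{hn}(d) ≥ h·n·C_n(d) − (h−1)·log₂(n+1). -/
open scoped BigOperators

noncomputable section

/-- Output alphabet of the binary deletion channel with `n` input bits:
a length `k ≤ n` together with a binary string of that length. -/
abbrev DelOut (n : ℕ) := Σ k : Fin (n + 1), (Fin (k : ℕ) → Bool)

/-- The subsequence of `x` indexed by `S` (taken in increasing order),
as an element of `DelOut n`. -/
def restrictSub {n : ℕ} (x : Fin n → Bool) (S : Finset (Fin n)) : DelOut n :=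
  ⟨⟨S.card, Nat.lt_succ_of_le (by simpa using Finset.card_le_univ S)⟩,
   fun i => x (S.orderEmbOfFin rfl i)⟩

/-- Transition probability of the binary deletion channel `W_n^d`: each input bit is
deleted independently with probability `d`. -/
def delW {n : ℕ} (d : ℝ) (x : Fin n → Bool) (y : DelOut n) : ℝ :=
  ∑ S : Finset (Fin n),
    if restrictSub x S = y then (1 - d) ^ S.card * d ^ (n - S.card) else 0

/-- Transition probability of the exact deletion channel `W_{n,k}`, which keeps exactly `k`
of the `n` input bits, the kept positions being a uniformly random `k`-subset; `k`-subsets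
are identified with strictly monotone maps `Fin k → Fin n`. -/
def exactW {n k : ℕ} (x : Fin n → Bool) (y : Fin k → Bool) : ℝ :=
  ((Finset.univ.filter fun f : Fin k → Fin n => StrictMono f ∧ x ∘ f = y).card : ℝ) /
    (n.choose k : ℝ)

/-- `p` is a probability distribution on the finite alphabet `α`. -/
def IsDist {α : Type*} [Fintype α] (p : α → ℝ) : Prop :=
  (∀ a, 0 ≤ p a) ∧ ∑ a, p a = 1

/-- Base-2 mutual information `I(X;Y)` between the input `X ~ p` and the output `Y`
of the channel with transition matrix `W`. -/
def mutualInfo {α β : Type*} [Fintype α] [Fintype β] (p : α → ℝ) (W : α → β → ℝ) : ℝ :=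
  ∑ x, ∑ y, p x * W x y * Real.logb 2 (W x y / ∑ x', p x' * W x' y)

/-- `C_n(d) = (1/n) · sup_p I(X ; W_n^d(X))`. -/
def Cn (n : ℕ) (d : ℝ) : ℝ :=
  (1 / (n : ℝ)) * ⨆ p : {p : (Fin n → Bool) → ℝ // IsDist p}, mutualInfo p.1 (delW d)

/-- `C_{n,k} = (1/n) · sup_p I(X ; W_{n,k}(X))`. -/
def Cnk (n k : ℕ) : ℝ :=
  (1 / (n : ℝ)) * ⨆ p : {p : (Fin n → Bool) → ℝ // IsDist p},
    mutualInfo p.1 (exactW (n := n) (k := k))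

/-- Capacity of the binary deletion channel: `C(d) = inf_{n ≥ 1} C_n(d)`. -/
def C (d : ℝ) : ℝ := ⨅ n : {m : ℕ // 1 ≤ m}, Cn n d

/-- Output distribution of the channel `W` at `y` dominates each single input contribution. -/
lemma mul_le_output {α β : Type*} [Fintype α] {p : α → ℝ} {W : α → β → ℝ}
    (hp : ∀ x, 0 ≤ p x) (hW : ∀ x y, 0 ≤ W x y) (x : α) (y : β) :
    p x * W x y ≤ ∑ x', p x' * W x' y :=
  Finset.single_le_sum (f := fun x' => p x' * W x' y)
    (fun x' _ => mul_nonneg (hp x') (hW x' y)) (Finset.mem_univ x)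

/-- Mutual information is bounded uniformly in the input distribution. -/
lemma mutualInfo_le_sum_div_log_two {α β : Type*} [Fintype α] [Fintype β] {p : α → ℝ}
    {W : α → β → ℝ} (hp : ∀ x, 0 ≤ p x) (hW : ∀ x y, 0 ≤ W x y) :
    mutualInfo p W ≤ ∑ x, ∑ y, W x y / Real.log 2 := by
  have hlog : 0 < Real.log 2 := Real.log_pos one_lt_two
  refine Finset.sum_le_sum fun x _ => Finset.sum_le_sum fun y _ => ?_
  rcases (hp x).eq_or_lt with h0 | hpx
  · rw [← h0]; simpa using div_nonneg (hW x y) hlog.le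
  rcases (hW x y).eq_or_lt with h0 | hWx
  · rw [← h0]; simp
  have hq := mul_le_output hp hW x y
  have hpos : 0 < p x * W x y := mul_pos hpx hWx
  have hqpos := hpos.trans_le hq
  set q := ∑ x', p x' * W x' y
  have h1 : Real.log (W x y / q) ≤ 1 / p x := by
    refine (Real.log_le_self (by positivity)).trans ?_
    rw [div_le_div_iff₀ hqpos hpx]
    linarith
  calc p x * W x y * Real.logb 2 (W x y / q)
      = p x * W x y * Real.log (W x y / q) / Real.log 2 := by rw [Real.logb]; ring
    _ ≤ p x * W x y * (1 / p x) / Real.log 2 := by gcongr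
    _ = W x y / Real.log 2 := by field_simp

/-- Mutual information is invariant under relabelling the input alphabet. -/
lemma mutualInfo_comp_equiv {α α' β : Type*} [Fintype α] [Fintype α'] [Fintype β] (e : α' ≃ α)
    (p : α → ℝ) (W : α → β → ℝ) :
    mutualInfo (fun a => p (e a)) (fun a => W (e a)) = mutualInfo p W := by
  unfold mutualInfo
  rw [← Equiv.sum_comp e]
  refine Finset.sum_congr rfl fun x _ => Finset.sum_congr rfl fun y _ => ?_
  rw [Equiv.sum_comp e fun a => p a * W a y]

/-- Mutual information is additive over independent inputs to a product channel. -/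
lemma mutualInfo_prod {α α' β β' : Type*} [Fintype α] [Fintype α'] [Fintype β] [Fintype β']
    {p : α → ℝ} {p' : α' → ℝ} {V : α → β → ℝ} {V' : α' → β' → ℝ}
    (hp : IsDist p) (hp' : IsDist p') (hV : ∀ x, IsDist (V x)) (hV' : ∀ x, IsDist (V' x)) :
    mutualInfo (fun x : α × α' => p x.1 * p' x.2)
        (fun x (y : β × β') => V x.1 y.1 * V' x.2 y.2) =
      mutualInfo p V + mutualInfo p' V' := by
  have hq (y : β) (y' : β') : ∑ x : α × α', p x.1 * p' x.2 * (V x.1 y * V' x.2 y') =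
      (∑ x, p x * V x y) * ∑ x, p' x * V' x y' := by
    rw [Fintype.sum_prod_type, Finset.sum_mul_sum]
    exact Finset.sum_congr rfl fun _ _ => Finset.sum_congr rfl fun _ _ => by ring
  have hone : ∑ x, ∑ y, p x * V x y = 1 := by
    simp_rw [← Finset.mul_sum, (hV _).2, mul_one, hp.2]
  have hone' : ∑ x, ∑ y, p' x * V' x y = 1 := by
    simp_rw [← Finset.mul_sum, (hV' _).2, mul_one, hp'.2]
  have hterm (x : α) (x' : α') (y : β) (y' : β') :
      p x * p' x' * (V x y * V' x' y') * Real.logb 2 (V x y * V' x' y' /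
        ((∑ x, p x * V x y) * ∑ x, p' x * V' x y')) =
      (p x * V x y * Real.logb 2 (V x y / ∑ x, p x * V x y)) * (p' x' * V' x' y') +
      (p x * V x y) * (p' x' * V' x' y' * Real.logb 2 (V' x' y' / ∑ x, p' x * V' x y')) := by
    by_cases h : p x * V x y = 0
    · rw [show p x * p' x' * (V x y * V' x' y') = p x * V x y * (p' x' * V' x' y') by ring, h]
      ring
    by_cases h' : p' x' * V' x' y' = 0
    · rw [show p x * p' x' * (V x y * V' x' y') = p x * V x y * (p' x' * V' x' y') by ring, h']
      ring
    have hpos := (mul_nonneg (hp.1 x) ((hV x).1 y)).lt_of_ne' h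
    have hpos' := (mul_nonneg (hp'.1 x') ((hV' x').1 y')).lt_of_ne' h'
    have hQ := hpos.trans_le (mul_le_output hp.1 (fun x => (hV x).1) x y)
    have hQ' := hpos'.trans_le (mul_le_output hp'.1 (fun x => (hV' x).1) x' y')
    rw [mul_div_mul_comm, Real.logb_mul (div_ne_zero (right_ne_zero_of_mul h) hQ.ne')
      (div_ne_zero (right_ne_zero_of_mul h') hQ'.ne')]
    ring
  have hsum (f g : α → β → ℝ) (f' g' : α' → β' → ℝ) :
      ∑ x : α × α', ∑ y : β × β', (f x.1 y.1 * f' x.2 y.2 + g x.1 y.1 * g' x.2 y.2) =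
      (∑ x, ∑ y, f x y) * (∑ x, ∑ y, f' x y) + (∑ x, ∑ y, g x y) * (∑ x, ∑ y, g' x y) := by
    simp only [Fintype.sum_prod_type, Finset.sum_add_distrib, ← Finset.mul_sum, ← Finset.sum_mul]
  unfold mutualInfo
  simp only [hq, hterm]
  rw [hsum (fun x y => p x * V x y * Real.logb 2 (V x y / ∑ x, p x * V x y))
    (fun x y => p x * V x y) (fun x y => p' x * V' x y)
    (fun x' y' => p' x' * V' x' y' * Real.logb 2 (V' x' y' / ∑ x, p' x * V' x y')),
    hone, hone', mul_one, one_mul]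

/-- Merging output symbols in groups of size at most `M` loses at most `log₂ M` bits. -/
lemma mutualInfo_le_of_fiber_card_le {α β γ : Type*} [Fintype α] [Fintype β] [Fintype γ]
    [DecidableEq β] {p : α → ℝ} {V : α → γ → ℝ} {W : α → β → ℝ} {M : ℕ} (g : γ → β)
    (hp : IsDist p) (hV : ∀ x, IsDist (V x))
    (hW : ∀ x y, W x y = ∑ c, if g c = y then V x c else 0)
    (hM : ∀ y, (Finset.univ.filter fun c => g c = y).card ≤ M) (hMpos : 0 < M) :
    mutualInfo p V ≤ mutualInfo p W + Real.logb 2 M := by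
  have hlog : 0 < Real.log 2 := Real.log_pos one_lt_two
  have hM' : (0 : ℝ) < M := by exact_mod_cast hMpos
  have hW0 (x y) : 0 ≤ W x y := by
    rw [hW]; exact Finset.sum_nonneg fun c _ => by split_ifs <;> simp [(hV x).1 c]
  have hVW (x c) : V x c ≤ W x (g c) := by
    rw [hW]
    have := Finset.single_le_sum (f := fun c' => if g c' = g c then V x c' else 0)
      (fun c' _ => by split_ifs <;> simp [(hV x).1 c']) (Finset.mem_univ c)
    simpa using this
  set q : γ → ℝ := fun c => ∑ x, p x * V x c with hq
  set r : β → ℝ := fun y => ∑ x, p x * W x y with hr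
  have hq0 (c) : 0 ≤ q c := Finset.sum_nonneg fun x _ => mul_nonneg (hp.1 x) ((hV x).1 c)
  have hr0 (y) : 0 ≤ r y := Finset.sum_nonneg fun x _ => mul_nonneg (hp.1 x) (hW0 x y)
  have hWsum (x) : ∑ y, W x y = 1 := by
    simp_rw [hW]
    rw [Finset.sum_comm]
    simp [(hV x).2]
  have hqsum : ∑ c, q c = 1 := by
    rw [hq, Finset.sum_comm]
    simp_rw [← Finset.mul_sum, (hV _).2, mul_one, hp.2]
  have hrsum : ∑ y, r y = 1 := by
    rw [hr, Finset.sum_comm]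
    simp_rw [← Finset.mul_sum, hWsum, mul_one, hp.2]
  have hIW : mutualInfo p W = ∑ x, ∑ c, p x * V x c * Real.logb 2 (W x (g c) / r (g c)) := by
    refine Finset.sum_congr rfl fun x _ => ?_
    have (y : β) : p x * W x y * Real.logb 2 (W x y / r y) =
        ∑ c, if g c = y then p x * V x c * Real.logb 2 (W x (g c) / r (g c)) else 0 := by
      conv_lhs => rw [mul_assoc, mul_comm (W x y), ← mul_assoc, hW x y, Finset.mul_sum, ← hW x y]
      refine Finset.sum_congr rfl fun c _ => ?_
      split_ifs with h
      · rw [h]; ring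
      · simp
    change ∑ y, p x * W x y * Real.logb 2 (W x y / r y) = _
    simp_rw [this]
    rw [Finset.sum_comm]
    simp
  have hterm (x c) : p x * V x c * Real.logb 2 (V x c / q c) ≤
      p x * V x c * Real.logb 2 (W x (g c) / r (g c)) + p x * V x c * Real.logb 2 M +
        p x * V x c * ((r (g c) / (M * q c) - 1) / Real.log 2) := by
    rcases (mul_nonneg (hp.1 x) ((hV x).1 c)).eq_or_lt with h | h
    · rw [← h]; simp
    rw [← mul_add, ← mul_add]
    refine mul_le_mul_of_nonneg_left ?_ h.le
    have hpx : 0 < p x := (hp.1 x).lt_of_ne' (left_ne_zero_of_mul h.ne')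
    have hVx : 0 < V x c := ((hV x).1 c).lt_of_ne' (right_ne_zero_of_mul h.ne')
    have hWx : 0 < W x (g c) := hVx.trans_le (hVW x c)
    have hqc : 0 < q c := h.trans_le (mul_le_output hp.1 (fun x => (hV x).1) x c)
    have hrc : 0 < r (g c) := (mul_pos hpx hWx).trans_le (mul_le_output hp.1 hW0 x (g c))
    have h1 : Real.logb 2 (V x c / q c) ≤
        Real.logb 2 (W x (g c) / r (g c) * M * (r (g c) / (M * q c))) := by
      refine Real.logb_le_logb_of_le one_lt_two (by positivity) ?_
      rw [show W x (g c) / r (g c) * M * (r (g c) / (M * q c)) = W x (g c) / q c by field_simp]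
      gcongr
      exact hVW x c
    rw [Real.logb_mul (by positivity) (by positivity),
      Real.logb_mul (by positivity) (by positivity)] at h1
    refine h1.trans (add_le_add_right ?_ _)
    rw [Real.logb]
    gcongr
    exact Real.log_le_sub_one_of_pos (by positivity)
  have hrest : ∑ x, ∑ c, p x * V x c * ((r (g c) / (M * q c) - 1) / Real.log 2) ≤ 0 := by
    rw [Finset.sum_comm]
    simp_rw [← Finset.sum_mul]
    have hc (c) : q c * ((r (g c) / (M * q c) - 1) / Real.log 2) ≤
        (r (g c) / M - q c) / Real.log 2 := by
      rw [← mul_div_assoc]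
      gcongr
      rcases (hq0 c).eq_or_lt with h | h
      · rw [← h]; simpa using div_nonneg (hr0 _) hM'.le
      · apply le_of_eq; field_simp
    refine (Finset.sum_le_sum fun c _ => hc c).trans ?_
    rw [← Finset.sum_div, Finset.sum_sub_distrib, hqsum, ← Finset.sum_div]
    have hfib : ∑ c, r (g c) ≤ M := by
      calc ∑ c, r (g c) = ∑ y, ∑ c, if g c = y then r y else 0 := by
            refine (Finset.sum_comm.trans (Finset.sum_congr rfl fun c _ => ?_)).symm
            simp
        _ = ∑ y, ((Finset.univ.filter fun c => g c = y).card : ℝ) * r y := by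
            simp [← Finset.sum_filter]
        _ ≤ ∑ y, (M : ℝ) * r y := Finset.sum_le_sum fun y _ =>
            mul_le_mul_of_nonneg_right (by exact_mod_cast hM y) (hr0 y)
        _ = M := by rw [← Finset.mul_sum, hrsum, mul_one]
    refine div_nonpos_of_nonpos_of_nonneg ?_ hlog.le
    have := (div_le_one hM').2 hfib
    linarith
  have hconst : ∑ x, ∑ c, p x * V x c * Real.logb 2 M = Real.logb 2 M := by
    simp only [← Finset.sum_mul, ← Finset.mul_sum, (hV _).2, mul_one, hp.2, one_mul]
  calc mutualInfo p V ≤ ∑ x, ∑ c, (p x * V x c * Real.logb 2 (W x (g c) / r (g c)) +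
        p x * V x c * Real.logb 2 M +
        p x * V x c * ((r (g c) / (M * q c) - 1) / Real.log 2)) :=
        Finset.sum_le_sum fun x _ => Finset.sum_le_sum fun c _ => hterm x c
    _ ≤ mutualInfo p W + Real.logb 2 M := by
      simp only [Finset.sum_add_distrib]
      rw [hconst, ← hIW]
      linarith

/-- A channel output as a list of bits. -/
def DelOut.toList {n : ℕ} (y : DelOut n) : List Bool := List.ofFn y.2

lemma DelOut.length_toList {n : ℕ} (y : DelOut n) : y.toList.length = y.1 := by
  simp [DelOut.toList]

lemma DelOut.toList_injective {n : ℕ} : Function.Injective (DelOut.toList (n := n)) := by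
  rintro ⟨⟨k, hk⟩, y⟩ ⟨⟨l, hl⟩, z⟩ h
  obtain rfl : k = l := by simpa [DelOut.length_toList] using congrArg List.length h
  obtain rfl : y = z := List.ofFn_injective h
  rfl

/-- Concatenation of channel outputs. -/
def DelOut.append {m n : ℕ} (y : DelOut m) (z : DelOut n) : DelOut (m + n) :=
  ⟨⟨y.1 + z.1, by have := y.1.2; have := z.1.2; lia⟩, Fin.append y.2 z.2⟩

lemma DelOut.toList_append {m n : ℕ} (y : DelOut m) (z : DelOut n) :
    (y.append z).toList = y.toList ++ z.toList :=
  List.ofFn_fin_append y.2 z.2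

lemma DelOut.card_append_fiber_le {m n : ℕ} (y : DelOut (m + n)) :
    (Finset.univ.filter fun c : DelOut m × DelOut n => c.1.append c.2 = y).card ≤ n + 1 := by
  refine le_of_le_of_eq ?_ (Finset.card_fin (n + 1))
  refine Finset.card_le_card_of_injOn (fun c => c.2.1) (by simp) ?_
  rintro ⟨a, b⟩ hab ⟨a', b'⟩ hab' h
  simp only [Finset.coe_filter, Finset.mem_univ, true_and, Set.mem_ofPred_eq] at hab hab' h
  have hl := congrArg DelOut.toList (hab.trans hab'.symm)
  rw [DelOut.toList_append, DelOut.toList_append] at hl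
  obtain ⟨h1, h2⟩ := List.append_inj' hl (by simp [DelOut.length_toList, h])
  rw [DelOut.toList_injective h1, DelOut.toList_injective h2]

lemma restrictSub_toList {n : ℕ} (x : Fin n → Bool) (S : Finset (Fin n)) :
    (restrictSub x S).toList = ((List.finRange n).filter (· ∈ S)).map x := by
  have hsort : (List.finRange n).filter (· ∈ S) = S.sort (· ≤ ·) := by
    refine List.Perm.eq_of_pairwise' (r := (· ≤ ·)) ?_ (Finset.pairwise_sort S _) ?_
    · exact ((List.pairwise_le_finRange n).filter _)
    · rw [List.perm_ext_iff_of_nodup ((List.nodup_finRange n).filter _) (Finset.sort_nodup _ _)]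
      simp
  rw [hsort]
  apply List.ext_getElem
  · simp [DelOut.toList, restrictSub]
  · intro i h1 h2
    simp [DelOut.toList, restrictSub, Finset.orderEmbOfFin_apply]

/-- A subset of `Fin (m + n)` is a pair of subsets of `Fin m` and `Fin n`. -/
def finsetFinAddEquiv (m n : ℕ) : Finset (Fin m) × Finset (Fin n) ≃ Finset (Fin (m + n)) :=
  (Finset.sumEquiv.toEquiv.symm).trans (Equiv.finsetCongr finSumFinEquiv)

lemma castAdd_mem_finsetFinAddEquiv {m n : ℕ} (S : Finset (Fin m) × Finset (Fin n)) (i : Fin m) :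
    Fin.castAdd n i ∈ finsetFinAddEquiv m n S ↔ i ∈ S.1 := by
  simp [finsetFinAddEquiv, ← finSumFinEquiv_apply_left]

lemma natAdd_mem_finsetFinAddEquiv {m n : ℕ} (S : Finset (Fin m) × Finset (Fin n)) (i : Fin n) :
    Fin.natAdd m i ∈ finsetFinAddEquiv m n S ↔ i ∈ S.2 := by
  simp [finsetFinAddEquiv, ← finSumFinEquiv_apply_right]

lemma card_finsetFinAddEquiv {m n : ℕ} (S : Finset (Fin m) × Finset (Fin n)) :
    (finsetFinAddEquiv m n S).card = S.1.card + S.2.card := by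
  simp [finsetFinAddEquiv]

lemma restrictSub_append {m n : ℕ} (x : Fin m → Bool) (x' : Fin n → Bool)
    (S : Finset (Fin m) × Finset (Fin n)) :
    restrictSub (Fin.append x x') (finsetFinAddEquiv m n S) =
      (restrictSub x S.1).append (restrictSub x' S.2) := by
  have hrange : List.finRange (m + n) =
      (List.finRange m).map (Fin.castAdd n) ++ (List.finRange n).map (Fin.natAdd m) := by
    simp only [← List.ofFn_id, List.ofFn_add, List.map_ofFn]
    rfl
  apply DelOut.toList_injective
  simp only [DelOut.toList_append, restrictSub_toList, hrange, List.filter_append, List.map_append,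
    List.filter_map, List.map_map, Function.comp_def, Fin.append_left, Fin.append_right,
    castAdd_mem_finsetFinAddEquiv, natAdd_mem_finsetFinAddEquiv]

lemma delW_isDist {n : ℕ} {d : ℝ} (hd : d ∈ Set.Icc (0 : ℝ) 1) (x : Fin n → Bool) :
    IsDist (delW d x) := by
  have hd0 := hd.1
  have hd1 : 0 ≤ 1 - d := sub_nonneg.2 hd.2
  refine ⟨fun y => Finset.sum_nonneg fun S _ => ?_, ?_⟩
  · split_ifs
    · positivity
    · rfl
  · unfold delW
    rw [Finset.sum_comm]
    have := Fintype.sum_pow_mul_eq_add_pow (Fin n) (1 - d) d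
    simpa using this

/-- The deletion channel on a concatenated input outputs the concatenation of independent
outputs of the deletion channels on the two parts. -/
lemma delW_append {m n : ℕ} (d : ℝ) (x : Fin m → Bool) (x' : Fin n → Bool)
    (y : DelOut (m + n)) :
    delW d (Fin.append x x') y =
      ∑ c : DelOut m × DelOut n, if c.1.append c.2 = y then delW d x c.1 * delW d x' c.2 else 0 := by
  have hprod (c : DelOut m × DelOut n) : delW d x c.1 * delW d x' c.2 =
      ∑ S : Finset (Fin m) × Finset (Fin n), if (restrictSub x S.1, restrictSub x' S.2) = c then
        (1 - d) ^ (S.1.card + S.2.card) * d ^ (m + n - (S.1.card + S.2.card)) else 0 := by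
    unfold delW
    rw [Finset.sum_mul_sum, Fintype.sum_prod_type]
    refine Finset.sum_congr rfl fun S _ => Finset.sum_congr rfl fun T _ => ?_
    have hS : S.card ≤ m := by simpa using Finset.card_le_univ S
    have hT : T.card ≤ n := by simpa using Finset.card_le_univ T
    rw [show m + n - (S.card + T.card) = (m - S.card) + (n - T.card) by lia, pow_add, pow_add]
    by_cases h1 : restrictSub x S = c.1 <;> by_cases h2 : restrictSub x' T = c.2 <;>
      simp [Prod.ext_iff, h1, h2]
    ring
  have hswap (c : DelOut m × DelOut n) :
      (if c.1.append c.2 = y then delW d x c.1 * delW d x' c.2 else 0) =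
      ∑ S : Finset (Fin m) × Finset (Fin n), if (restrictSub x S.1, restrictSub x' S.2) = c then
        if (restrictSub x S.1).append (restrictSub x' S.2) = y then
          (1 - d) ^ (S.1.card + S.2.card) * d ^ (m + n - (S.1.card + S.2.card)) else 0
        else 0 := by
    rw [hprod]
    split_ifs with hc
    · refine Finset.sum_congr rfl fun S _ => ?_
      split_ifs with h1 h2
      · rfl
      · subst h1; exact absurd hc h2
      · rfl
    · refine (Finset.sum_eq_zero fun S _ => ?_).symm
      split_ifs with h1 h2
      · subst h1; exact absurd h2 hc
      · rfl
      · rfl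
  simp_rw [hswap]
  rw [Finset.sum_comm, delW, ← Equiv.sum_comp (finsetFinAddEquiv m n)]
  simp [restrictSub_append, card_finsetFinAddEquiv]

/-- The unnormalised capacity `sup_p I(X ; W_n^d(X))`. -/
def delSup (n : ℕ) (d : ℝ) : ℝ :=
  ⨆ p : {p : (Fin n → Bool) → ℝ // IsDist p}, mutualInfo p.1 (delW d)

lemma bddAbove_mutualInfo_delW {n : ℕ} {d : ℝ} (hd : d ∈ Set.Icc (0 : ℝ) 1) :
    BddAbove (Set.range fun p : {p : (Fin n → Bool) → ℝ // IsDist p} =>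
      mutualInfo p.1 (delW d)) := by
  refine ⟨∑ x : Fin n → Bool, ∑ y, delW d x y / Real.log 2, ?_⟩
  rintro _ ⟨p, rfl⟩
  exact mutualInfo_le_sum_div_log_two p.2.1 fun x => (delW_isDist hd x).1

/-- Superadditivity of the unnormalised capacity up to the entropy of the length of the
second output block. -/
lemma delSup_add_le {d : ℝ} (hd : d ∈ Set.Icc (0 : ℝ) 1) (m n : ℕ) :
    delSup m d + delSup n d ≤ delSup (m + n) d + Real.logb 2 (n + 1) := by
  have hpair (p : {p : (Fin m → Bool) → ℝ // IsDist p})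
      (p' : {p : (Fin n → Bool) → ℝ // IsDist p}) :
      mutualInfo p.1 (delW d) + mutualInfo p'.1 (delW d) ≤
        delSup (m + n) d + Real.logb 2 (n + 1) := by
    let e := Fin.appendEquiv (α := Bool) m n
    let P : (Fin (m + n) → Bool) → ℝ := fun x => p.1 (e.symm x).1 * p'.1 (e.symm x).2
    have hprodDist : IsDist fun x : (Fin m → Bool) × (Fin n → Bool) => p.1 x.1 * p'.1 x.2 :=
      ⟨fun x => mul_nonneg (p.2.1 _) (p'.2.1 _), by
        rw [Fintype.sum_prod_type, ← Finset.sum_mul_sum, p.2.2, p'.2.2, one_mul]⟩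
    have hP : IsDist P :=
      ⟨fun x => hprodDist.1 _, (Equiv.sum_comp e.symm _).trans hprodDist.2⟩
    have hle : mutualInfo P (delW d) ≤ delSup (m + n) d :=
      le_ciSup (bddAbove_mutualInfo_delW hd) ⟨P, hP⟩
    rw [← mutualInfo_prod p.2 p'.2 (delW_isDist hd) (delW_isDist hd)]
    refine le_trans ?_ (add_le_add_left hle _)
    rw [← mutualInfo_comp_equiv e]
    have hPe : (fun a => P (e a)) = fun x => p.1 x.1 * p'.1 x.2 := by
      funext a; simp [P]
    rw [hPe]
    have := mutualInfo_le_of_fiber_card_le (M := n + 1)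
      (V := fun x (y : DelOut m × DelOut n) => delW d x.1 y.1 * delW d x.2 y.2)
      (W := fun a => delW d (e a)) (fun c => c.1.append c.2) hprodDist
      (fun x => ⟨fun y => mul_nonneg ((delW_isDist hd _).1 _) ((delW_isDist hd _).1 _), by
        rw [Fintype.sum_prod_type, ← Finset.sum_mul_sum, (delW_isDist hd _).2,
          (delW_isDist hd _).2, one_mul]⟩)
      (fun x y => delW_append d x.1 x.2 y) DelOut.card_append_fiber_le n.succ_pos
    simpa using this
  have hne (k : ℕ) : Nonempty {p : (Fin k → Bool) → ℝ // IsDist p} :=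
    ⟨⟨fun x => if x = fun _ => false then 1 else 0,
      fun x => by dsimp only; split_ifs <;> simp, by simp⟩⟩
  have := hne m
  have := hne n
  rw [← le_sub_iff_add_le]
  refine ciSup_le fun p => ?_
  rw [le_sub_iff_add_le, ← le_sub_iff_add_le']
  refine ciSup_le fun p' => ?_
  rw [le_sub_iff_add_le']
  exact hpair p p'

lemma natCast_mul_Cn {n : ℕ} (hn : 1 ≤ n) (d : ℝ) : (n : ℝ) * Cn n d = delSup n d := by
  have : (n : ℝ) ≠ 0 := by positivity
  rw [Cn, delSup, one_div, mul_inv_cancel_left₀ this]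

/-- For every `d ∈ [0,1]` and all integers `n ≥ 1`, `h ≥ 1`,
`h·n·C_{hn}(d) ≥ h·n·C_n(d) − (h−1)·log₂(n+1)`. -/
theorem Cn_superadditive_bound (d : ℝ) (hd : d ∈ Set.Icc (0 : ℝ) 1)
    (n h : ℕ) (hn : 1 ≤ n) (hh : 1 ≤ h) :
    (h : ℝ) * n * Cn (h * n) d ≥
      (h : ℝ) * n * Cn n d - ((h : ℝ) - 1) * Real.logb 2 (n + 1) := by
  have key : (h : ℝ) * delSup n d - ((h : ℝ) - 1) * Real.logb 2 (n + 1) ≤ delSup (h * n) d := by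
    induction h, hh using Nat.le_induction with
    | base => simp
    | succ k hk ih =>
      rw [Nat.succ_mul]
      have := delSup_add_le hd (k * n) n
      push_cast
      linarith
  have h1 := natCast_mul_Cn (Nat.mul_pos hh hn) d
  rw [Nat.cast_mul] at h1
  rw [ge_iff_le, h1, mul_assoc, natCast_mul_Cn hn]
  exact key
end
end

section
/- For every ε > 0, every d ∈ [ε, 1−ε], and every integer n ≥ 1, C_{n,⌈(1−d−ε)n⌉} − 2e^{−2ε²n} ≤ C_n(d) ≤ C_{n,⌊(1−d+ε)n⌋} + 2e^{−2ε²n}. -/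
open scoped BigOperators

noncomputable section

/-- The log-sum inequality. -/
lemma log_sum_inequality {ι : Type*} (s : Finset ι) (a b : ι → ℝ) (ha : ∀ i ∈ s, 0 ≤ a i)
    (hb : ∀ i ∈ s, 0 ≤ b i) (hab : ∀ i ∈ s, b i = 0 → a i = 0) :
    (∑ i ∈ s, a i) * Real.log ((∑ i ∈ s, a i) / ∑ i ∈ s, b i) ≤
      ∑ i ∈ s, a i * Real.log (a i / b i) := by
  set A := ∑ i ∈ s, a i with hA
  set B := ∑ i ∈ s, b i with hB
  rcases (Finset.sum_nonneg ha).eq_or_lt with hA0 | hA0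
  · have h0 := (Finset.sum_eq_zero_iff_of_nonneg ha).1 hA0.symm
    rw [← hA] at hA0
    rw [← hA0, Finset.sum_eq_zero fun i hi => by rw [h0 i hi, zero_mul]]
    simp
  rw [← hA] at hA0
  have hB0 : 0 < B := by
    rcases (Finset.sum_nonneg hb).eq_or_lt with h | h
    · have h0 := (Finset.sum_eq_zero_iff_of_nonneg hb).1 h.symm
      have : A = 0 := Finset.sum_eq_zero fun i hi => hab i hi (h0 i hi)
      exact absurd this hA0.ne'
    · exact h
  have key : ∀ i ∈ s, a i * Real.log (A / B) + (a i - b i * (A / B)) ≤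
      a i * Real.log (a i / b i) := by
    intro i hi
    rcases (ha i hi).eq_or_lt with h | h
    · rw [← h]
      have : 0 ≤ b i * (A / B) := mul_nonneg (hb i hi) (by positivity)
      simpa using this
    · have hbi : 0 < b i := lt_of_le_of_ne (hb i hi) fun h' => h.ne' (hab i hi h'.symm)
      have h1 := Real.one_sub_inv_le_log_of_pos (x := a i / b i / (A / B)) (by positivity)
      rw [Real.log_div (by positivity) (by positivity)] at h1
      have h2 := mul_le_mul_of_nonneg_left h1 h.le
      have h3 : a i * (1 - (a i / b i / (A / B))⁻¹) = a i - b i * (A / B) := by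
        field_simp
      linarith
  have := Finset.sum_le_sum key
  rw [Finset.sum_add_distrib, Finset.sum_sub_distrib, ← Finset.sum_mul, ← Finset.sum_mul,
    ← hA, ← hB, mul_div_cancel₀ _ hB0.ne'] at this
  linarith

/-- Data processing: post-composing a channel with a stochastic matrix does not increase
mutual information. -/
lemma mutualInfo_comp_le {α β γ : Type*} [Fintype α] [Fintype β] [Fintype γ] (p : α → ℝ)
    (hp : ∀ a, 0 ≤ p a) (W : α → β → ℝ) (hW : ∀ x y, 0 ≤ W x y) (V : β → γ → ℝ)
    (hV : ∀ y z, 0 ≤ V y z) (hV1 : ∀ y, ∑ z, V y z = 1) :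
    mutualInfo p (fun x z => ∑ y, W x y * V y z) ≤ mutualInfo p W := by
  unfold mutualInfo
  refine Finset.sum_le_sum fun x _ => ?_
  have hq : ∀ z, ∑ x', p x' * ∑ y, W x' y * V y z = ∑ y, (∑ x', p x' * W x' y) * V y z := by
    intro z
    simp only [Finset.mul_sum, Finset.sum_mul]
    rw [Finset.sum_comm]
    simp only [mul_assoc]
  have hR : ∑ y, p x * W x y * Real.logb 2 (W x y / ∑ x', p x' * W x' y) =
      ∑ z, ∑ y, p x * (W x y * V y z) * Real.logb 2 (W x y / ∑ x', p x' * W x' y) := by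
    rw [Finset.sum_comm]
    refine Finset.sum_congr rfl fun y _ => ?_
    rw [← Finset.sum_mul, ← Finset.mul_sum, ← Finset.mul_sum, hV1, mul_one]
  rw [hR]
  refine Finset.sum_le_sum fun z _ => ?_
  rcases (hp x).eq_or_lt with h | h
  · simp [← h]
  rw [hq]
  have := log_sum_inequality Finset.univ (fun y => W x y * V y z)
    (fun y => (∑ x', p x' * W x' y) * V y z) (fun y _ => mul_nonneg (hW _ _) (hV _ _))
    (fun y _ => mul_nonneg (Finset.sum_nonneg fun x' _ => mul_nonneg (hp _) (hW _ _)) (hV _ _))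
    (fun y _ h0 => by
      rcases mul_eq_zero.1 h0 with h1 | h1
      · have := (Finset.sum_eq_zero_iff_of_nonneg
          fun x' _ => mul_nonneg (hp x') (hW x' y)).1 h1 x (Finset.mem_univ _)
        rcases mul_eq_zero.1 this with h2 | h2
        · exact absurd h2 h.ne'
        · simp [h2]
      · simp [h1])
  have hterm : ∀ y, W x y * V y z * Real.log (W x y * V y z / ((∑ x', p x' * W x' y) * V y z)) =
      W x y * V y z * Real.log (W x y / ∑ x', p x' * W x' y) := by
    intro y
    rcases eq_or_ne (V y z) 0 with h0 | h0
    · simp [h0]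
    · rw [mul_div_mul_right _ _ h0]
  simp only [hterm] at this
  simp only [Real.logb, mul_assoc (p x), ← Finset.mul_sum]
  refine mul_le_mul_of_nonneg_left ?_ h.le
  simp only [← mul_div_assoc, ← Finset.sum_div]
  exact div_le_div_of_nonneg_right this (Real.log_pos one_lt_two).le

lemma mutualInfo_le_logb_card {α β : Type*} [Fintype α] [Fintype β] (p : α → ℝ) (hp : IsDist p)
    (W : α → β → ℝ) (hW : ∀ x y, 0 ≤ W x y) (hW1 : ∀ x, ∑ y, W x y = 1) :
    mutualInfo p W ≤ Real.logb 2 (Fintype.card α) := by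
  classical
  have h1 := mutualInfo_comp_le p hp.1 (fun x x' : α => if x = x' then (1 : ℝ) else 0)
    (fun x x' => by positivity) W hW hW1
  simp only [ite_mul, one_mul, zero_mul, Finset.sum_ite_eq, Finset.mem_univ, if_true] at h1
  refine h1.trans ?_
  have h2 := log_sum_inequality Finset.univ p (fun _ => 1) (fun i _ => hp.1 i)
    (fun _ _ => zero_le_one) (fun _ _ h => absurd h one_ne_zero)
  simp only [hp.2, Finset.sum_const, Finset.card_univ, nsmul_eq_mul, mul_one, one_mul, div_one,
    one_div, Real.log_inv] at h2
  simp only [mutualInfo, mul_ite, mul_one, mul_zero, ite_mul, zero_mul, Finset.sum_ite_eq,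
    Finset.sum_ite_eq', Finset.mem_univ, if_true, one_div, Real.logb, Real.log_inv,
    ← mul_div_assoc, ← Finset.sum_div, mul_neg, Finset.sum_neg_distrib]
  exact div_le_div_of_nonneg_right (by linarith) (Real.log_pos one_lt_two).le

section Subsequences

lemma orderEmbOfFin_image_eq {n k : ℕ} {f : Fin k → Fin n} (hf : StrictMono f)
    (h : (Finset.univ.image f).card = k) : ⇑((Finset.univ.image f).orderEmbOfFin h) = f :=
  (Finset.orderEmbOfFin_unique h (fun i => Finset.mem_image_of_mem f (Finset.mem_univ i)) hf).symm

lemma card_image_strictMono {n k : ℕ} {f : Fin k → Fin n} (hf : StrictMono f) :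
    (Finset.univ.image f).card = k := by
  rw [Finset.card_image_of_injective _ hf.injective, Finset.card_univ, Fintype.card_fin]

lemma strictMono_eq_of_image_eq {n k : ℕ} {f g : Fin k → Fin n} (hf : StrictMono f)
    (hg : StrictMono g) (h : Finset.univ.image f = Finset.univ.image g) : f = g := by
  rw [← orderEmbOfFin_image_eq hf (card_image_strictMono hf),
    ← orderEmbOfFin_image_eq hg (card_image_strictMono hg)]
  simp only [h]

lemma card_strictMono_fin (n k : ℕ) :
    (Finset.univ.filter fun f : Fin k → Fin n => StrictMono f).card = n.choose k := by
  conv_rhs => rw [← Finset.card_fin n, ← Finset.card_powersetCard]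
  refine Finset.card_bij (fun f _ => Finset.univ.image f) ?_ ?_ ?_
  · intro f hf
    simp only [Finset.mem_filter, Finset.mem_univ, true_and] at hf
    simp [Finset.mem_powersetCard, card_image_strictMono hf]
  · intro f hf g hg h
    simp only [Finset.mem_filter, Finset.mem_univ, true_and] at hf hg
    exact strictMono_eq_of_image_eq hf hg h
  · intro S hS
    have hS := (Finset.mem_powersetCard.1 hS).2
    exact ⟨S.orderEmbOfFin hS, by simp [OrderEmbedding.strictMono], Finset.image_orderEmbOfFin_univ S hS⟩

lemma card_factorizations {n k : ℕ} {h : Fin k → Fin n} (hh : StrictMono h) :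
    (Finset.univ.filter fun fg : (Fin (k + 1) → Fin n) × (Fin k → Fin (k + 1)) =>
      (StrictMono fg.1 ∧ StrictMono fg.2) ∧ fg.1 ∘ fg.2 = h).card = n - k := by
  have hc : ((Finset.univ.image h)ᶜ).card = n - k := by
    rw [Finset.card_compl, card_image_strictMono hh, Fintype.card_fin]
  rw [← hc]
  symm
  have hcard : ∀ a ∈ (Finset.univ.image h)ᶜ, (insert a (Finset.univ.image h)).card = k + 1 := by
    intro a ha
    rw [Finset.card_insert_of_notMem (Finset.mem_compl.1 ha), card_image_strictMono hh]
  have hex : ∀ a (ha : a ∈ (Finset.univ.image h)ᶜ), ∃ g : Fin k → Fin (k + 1),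
      ∀ i, (insert a (Finset.univ.image h)).orderEmbOfFin (hcard a ha) (g i) = h i := by
    intro a ha
    have : ∀ i, h i ∈ Set.range ((insert a (Finset.univ.image h)).orderEmbOfFin (hcard a ha)) := by
      intro i; rw [Finset.range_orderEmbOfFin]; simp
    exact Classical.skolem.1 this
  choose g hg using hex
  refine Finset.card_bij
    (fun a ha => (⇑((insert a (Finset.univ.image h)).orderEmbOfFin (hcard a ha)), g a ha)) ?_ ?_ ?_
  · intro a ha
    simp only [Finset.mem_filter, Finset.mem_univ, true_and]
    refine ⟨⟨OrderEmbedding.strictMono _, fun i j hij => ?_⟩, funext fun i => hg a ha i⟩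
    rw [← ((insert a (Finset.univ.image h)).orderEmbOfFin (hcard a ha)).lt_iff_lt, hg, hg]
    exact hh hij
  · intro a ha b hb hab
    have h1 := congrArg (fun F => Finset.univ.image F) (Prod.ext_iff.1 hab).1
    simp only [Finset.image_orderEmbOfFin_univ] at h1
    have h2 : a ∈ insert b (Finset.univ.image h) := h1 ▸ Finset.mem_insert_self _ _
    exact (Finset.mem_insert.1 h2).resolve_right (Finset.mem_compl.1 ha)
  · rintro ⟨f, g'⟩ hfg
    simp only [Finset.mem_filter, Finset.mem_univ, true_and] at hfg
    obtain ⟨⟨hf, hg'⟩, hcomp⟩ := hfg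
    have hsub : Finset.univ.image h ⊆ Finset.univ.image f := by
      rw [← hcomp]
      intro b hb
      obtain ⟨i, -, rfl⟩ := Finset.mem_image.1 hb
      exact Finset.mem_image_of_mem f (Finset.mem_univ (g' i))
    obtain ⟨a, ha, hins⟩ := (Finset.covBy_iff_exists_insert (s := Finset.univ.image h)
      (t := Finset.univ.image f)).1 (Finset.covBy_iff_card_sdiff_eq_one.2 ⟨hsub, by
        rw [Finset.card_sdiff_of_subset hsub, card_image_strictMono hf,
          card_image_strictMono hh]; omega⟩)
    have hac := Finset.mem_compl.2 ha
    have hfe : ⇑((insert a (Finset.univ.image h)).orderEmbOfFin (hcard a hac)) = f := by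
      refine strictMono_eq_of_image_eq (OrderEmbedding.strictMono _) hf ?_
      rw [Finset.image_orderEmbOfFin_univ, hins]
    refine ⟨a, hac, Prod.ext hfe (funext fun i => hf.injective ?_)⟩
    have := hg a hac i
    rw [hfe] at this
    rw [this, ← hcomp]
    rfl

end Subsequences

lemma exactW_nonneg {n k : ℕ} (x : Fin n → Bool) (y : Fin k → Bool) : 0 ≤ exactW x y := by
  unfold exactW; positivity

lemma exactW_eq_sum {n k : ℕ} (x : Fin n → Bool) (y : Fin k → Bool) :
    exactW x y = (∑ f ∈ Finset.univ.filter (fun f : Fin k → Fin n => StrictMono f),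
      if x ∘ f = y then (1 : ℝ) else 0) / (n.choose k : ℝ) := by
  unfold exactW
  rw [Finset.sum_boole, Finset.filter_filter]

lemma sum_exactW {n k : ℕ} (hk : k ≤ n) (x : Fin n → Bool) :
    ∑ y : Fin k → Bool, exactW x y = 1 := by
  have : (n.choose k : ℝ) ≠ 0 := by exact_mod_cast (Nat.choose_pos hk).ne'
  simp only [exactW_eq_sum, ← Finset.sum_div]
  rw [Finset.sum_comm]
  simp [card_strictMono_fin, this]

/-- Keeping `k` bits amounts to keeping `k + 1` bits and then dropping a random one of them. -/
lemma exactW_eq_comp {n k : ℕ} (hk : k < n) (x : Fin n → Bool) (z : Fin k → Bool) :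
    exactW x z = ∑ y : Fin (k + 1) → Bool, exactW x y * exactW y z := by
  have hN : ∑ y : Fin (k + 1) → Bool,
      (∑ f ∈ Finset.univ.filter (fun f : Fin (k + 1) → Fin n => StrictMono f),
        if x ∘ f = y then (1 : ℝ) else 0) *
      (∑ g ∈ Finset.univ.filter (fun g : Fin k → Fin (k + 1) => StrictMono g),
        if y ∘ g = z then (1 : ℝ) else 0) =
      ∑ fg ∈ Finset.univ.filter (fun fg : (Fin (k + 1) → Fin n) × (Fin k → Fin (k + 1)) =>
        StrictMono fg.1 ∧ StrictMono fg.2),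
        if x ∘ (fg.1 ∘ fg.2) = z then (1 : ℝ) else 0 := by
    simp only [Finset.sum_mul]
    rw [Finset.sum_comm]
    simp only [ite_mul, one_mul, zero_mul, Finset.sum_ite_eq, Finset.mem_univ, if_true]
    rw [← Finset.sum_product', ← Finset.univ_product_univ, Finset.filter_product]
    rfl
  have hF : ∑ fg ∈ Finset.univ.filter (fun fg : (Fin (k + 1) → Fin n) × (Fin k → Fin (k + 1)) =>
        StrictMono fg.1 ∧ StrictMono fg.2),
        (if x ∘ (fg.1 ∘ fg.2) = z then (1 : ℝ) else 0) =
      ((n : ℝ) - k) * ∑ h ∈ Finset.univ.filter (fun h : Fin k → Fin n => StrictMono h),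
        if x ∘ h = z then (1 : ℝ) else 0 := by
    rw [← Finset.sum_fiberwise_of_maps_to (g := fun fg => fg.1 ∘ fg.2)
      (t := Finset.univ.filter (fun h : Fin k → Fin n => StrictMono h)) (by
        intro fg hfg
        simp only [Finset.mem_filter, Finset.mem_univ, true_and] at hfg ⊢
        exact hfg.1.comp hfg.2), Finset.mul_sum]
    refine Finset.sum_congr rfl fun h hh => ?_
    simp only [Finset.mem_filter, Finset.mem_univ, true_and] at hh
    rw [Finset.sum_congr rfl (g := fun _ => if x ∘ h = z then (1 : ℝ) else 0) (by
      intro fg hfg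
      rw [(Finset.mem_filter.1 hfg).2]), Finset.sum_const, nsmul_eq_mul, Finset.filter_filter,
      card_factorizations hh, Nat.cast_sub hk.le]
  have hch : (n.choose (k + 1) : ℝ) * (k + 1) = n.choose k * ((n : ℝ) - k) := by
    have := Nat.choose_succ_right_eq n k
    rw [← Nat.cast_sub hk.le]
    exact_mod_cast this
  have h1 : (n.choose k : ℝ) ≠ 0 := by exact_mod_cast (Nat.choose_pos hk.le).ne'
  have h2 : (n.choose (k + 1) : ℝ) ≠ 0 := by
    exact_mod_cast (Nat.choose_pos (Nat.succ_le_of_lt hk)).ne'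
  have h3 : (k : ℝ) + 1 ≠ 0 := by positivity
  simp only [exactW_eq_sum, div_mul_div_comm, ← Finset.sum_div]
  rw [hN, hF, Nat.choose_succ_self_right, Nat.cast_add, Nat.cast_one, hch]
  have h4 : (n : ℝ) - k ≠ 0 := by
    have : (k : ℝ) < n := by exact_mod_cast hk
    linarith
  field_simp

section MutualInfoExact

variable {n : ℕ} {p : (Fin n → Bool) → ℝ}

lemma mutualInfo_exactW_mono (hp : IsDist p) {j k : ℕ} (hjk : j ≤ k) (hk : k ≤ n) :
    mutualInfo p (exactW (n := n) (k := j)) ≤ mutualInfo p (exactW (n := n) (k := k)) := by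
  induction k, hjk using Nat.le_induction with
  | base => exact le_rfl
  | succ k hjk ih =>
    refine (ih (by omega)).trans ?_
    have h : (exactW (n := n) (k := k)) =
        fun x z => ∑ y : Fin (k + 1) → Bool, exactW x y * exactW y z :=
      funext fun x => funext fun z => exactW_eq_comp (by omega) x z
    rw [h]
    exact mutualInfo_comp_le p hp.1 _ exactW_nonneg _ exactW_nonneg
      (sum_exactW (Nat.le_succ k))

lemma mutualInfo_exactW_nonneg (hp : IsDist p) {k : ℕ} (hk : k ≤ n) :
    0 ≤ mutualInfo p (exactW (n := n) (k := k)) := by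
  refine le_trans (le_of_eq ?_) (mutualInfo_exactW_mono hp (Nat.zero_le k) hk)
  have h : ∀ (x : Fin n → Bool) (y : Fin 0 → Bool), exactW x y = 1 := by
    intro x y
    rw [← sum_exactW (Nat.zero_le n) x, Fintype.sum_subsingleton _ y]
  simp [mutualInfo, h, hp.2]

lemma mutualInfo_exactW_le (hp : IsDist p) {k : ℕ} (hk : k ≤ n) :
    mutualInfo p (exactW (n := n) (k := k)) ≤ n := by
  refine (mutualInfo_le_logb_card p hp _ exactW_nonneg (sum_exactW hk)).trans (le_of_eq ?_)
  simp [Real.logb_pow]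

end MutualInfoExact

lemma restrictSub_eq_iff {n : ℕ} (x : Fin n → Bool) (S : Finset (Fin n)) (k : Fin (n + 1))
    (y : Fin (k : ℕ) → Bool) :
    restrictSub x S = ⟨k, y⟩ ↔ ∃ h : S.card = k, x ∘ S.orderEmbOfFin h = y := by
  obtain ⟨k, hk⟩ := k
  constructor
  · intro h
    have h1 : S.card = k := congrArg (fun s : DelOut n => (s.1 : ℕ)) h
    subst h1
    exact ⟨rfl, eq_of_heq (Sigma.mk.inj h).2⟩
  · rintro ⟨h, hy⟩
    dsimp only at h
    subst h
    subst hy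
    rfl

lemma delW_eq {n : ℕ} (d : ℝ) (x : Fin n → Bool) (k : Fin (n + 1)) (y : Fin (k : ℕ) → Bool) :
    delW d x ⟨k, y⟩ = ((1 - d) ^ (k : ℕ) * d ^ (n - k) * n.choose k) * exactW x y := by
  have hc : (n.choose k : ℝ) ≠ 0 := by
    exact_mod_cast (Nat.choose_pos (Nat.lt_succ_iff.1 k.2)).ne'
  have hcard : (Finset.univ.filter fun S : Finset (Fin n) => restrictSub x S = ⟨k, y⟩).card =
      (Finset.univ.filter fun f : Fin k → Fin n => StrictMono f ∧ x ∘ f = y).card := by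
    symm
    refine Finset.card_bij (fun f _ => Finset.univ.image f) ?_ ?_ ?_
    · intro f hf
      simp only [Finset.mem_filter, Finset.mem_univ, true_and, restrictSub_eq_iff] at hf ⊢
      exact ⟨card_image_strictMono hf.1, by rw [orderEmbOfFin_image_eq hf.1]; exact hf.2⟩
    · intro f hf g hg h
      simp only [Finset.mem_filter, Finset.mem_univ, true_and] at hf hg
      exact strictMono_eq_of_image_eq hf.1 hg.1 h
    · intro S hS
      simp only [Finset.mem_filter, Finset.mem_univ, true_and, restrictSub_eq_iff] at hS
      obtain ⟨h, hy⟩ := hS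
      exact ⟨S.orderEmbOfFin h, by simp [OrderEmbedding.strictMono, hy], Finset.image_orderEmbOfFin_univ S h⟩
  unfold delW exactW
  rw [← Finset.sum_filter, Finset.sum_congr rfl
    (g := fun _ => (1 - d) ^ (k : ℕ) * d ^ (n - k)) (by
      intro S hS
      obtain ⟨h, -⟩ := (restrictSub_eq_iff x S k y).1 (Finset.mem_filter.1 hS).2
      rw [h]), Finset.sum_const, nsmul_eq_mul, hcard]
  field_simp

/-- The length of the output is independent of the input, so the deletion channel is a binomial
mixture of exact deletion channels, with the mixing index visible at the output. -/
lemma mutualInfo_delW {n : ℕ} (p : (Fin n → Bool) → ℝ) (d : ℝ) :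
    mutualInfo p (delW d) = ∑ k ∈ Finset.range (n + 1),
      ((1 - d) ^ k * d ^ (n - k) * n.choose k) * mutualInfo p (exactW (n := n) (k := k)) := by
  rw [Finset.sum_range]
  simp only [mutualInfo, Fintype.sum_sigma, delW_eq]
  rw [Finset.sum_comm]
  refine Finset.sum_congr rfl fun k _ => ?_
  rw [Finset.mul_sum]
  refine Finset.sum_congr rfl fun x _ => ?_
  rw [Finset.mul_sum]
  refine Finset.sum_congr rfl fun y _ => ?_
  generalize (1 - d) ^ (k : ℕ) * d ^ (n - k) * (n.choose k : ℝ) = b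
  rcases eq_or_ne b 0 with rfl | hb
  · simp
  · simp only [mul_left_comm _ b]
    rw [← Finset.mul_sum, mul_div_mul_left _ _ hb, mul_assoc]

open MeasureTheory ProbabilityTheory in
/-- Hoeffding's lemma for a Bernoulli variable. -/
lemma bernoulli_mgf_le {q : ℝ} (hq0 : 0 ≤ q) (hq1 : q ≤ 1) (t : ℝ) :
    q * Real.exp t + (1 - q) ≤ Real.exp (q * t + t ^ 2 / 8) := by
  let μ : Measure ℝ := ENNReal.ofReal q • Measure.dirac 1 + ENNReal.ofReal (1 - q) •
    Measure.dirac 0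
  have hint : ∀ f : ℝ → ℝ, ∫ x, f x ∂μ = q * f 1 + (1 - q) * f 0 := by
    intro f
    have h : ∀ a : ℝ, Integrable f (Measure.dirac a) := fun a => integrable_dirac (by simp)
    rw [integral_add_measure ((h 1).smul_measure ENNReal.ofReal_ne_top)
      ((h 0).smul_measure ENNReal.ofReal_ne_top), integral_smul_measure, integral_smul_measure]
    simp [hq0, hq1]
  have : IsProbabilityMeasure μ := ⟨by
    simp only [μ, Measure.add_apply, Measure.smul_apply, measure_univ, smul_eq_mul, mul_one]
    rw [← ENNReal.ofReal_add hq0 (by linarith)]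
    simp⟩
  have hs := hasSubgaussianMGF_of_mem_Icc (μ := μ) (X := id) (a := 0) (b := 1)
    aemeasurable_id (by
      simp only [μ, ae_add_measure_iff]
      constructor <;> refine Measure.ae_smul_measure ?_ _ <;> simp [ae_dirac_eq])
  have hm := hs.mgf_le t
  simp only [mgf, hint, id] at hm
  simp only [mul_one, mul_zero, add_zero] at hm
  have h1 : Real.exp (t * (1 - q)) = Real.exp t * Real.exp (-(q * t)) := by
    rw [← Real.exp_add]; ring_nf
  have h2 : Real.exp (t * (0 - q)) = Real.exp (-(q * t)) := by ring_nf
  rw [h1, h2] at hm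
  have h3 : Real.exp (q * t + t ^ 2 / 8) = Real.exp (q * t) * Real.exp (t ^ 2 / 8) :=
    Real.exp_add _ _
  have h4 : Real.exp (q * t) * Real.exp (-(q * t)) = 1 := by
    rw [← Real.exp_add]; simp
  have h5 := mul_le_mul_of_nonneg_left hm (Real.exp_pos (q * t)).le
  rw [h3]
  refine le_trans (le_of_eq ?_) (h5.trans (le_of_eq ?_))
  · linear_combination (-(q * Real.exp t + (1 - q))) * h4
  · congr 2
    simp
    ring

/-- Chernoff–Hoeffding bound for the binomial distribution, in moment form. -/
lemma sum_binomial_mul_exp_le {d : ℝ} (hd0 : 0 ≤ d) (hd1 : d ≤ 1) (n : ℕ) (ε s : ℝ)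
    (hs : s ^ 2 = 1) :
    ∑ k ∈ Finset.range (n + 1), ((1 - d) ^ k * d ^ (n - k) * n.choose k) *
      Real.exp (4 * ε * s * (k - (1 - d + s * ε) * n)) ≤ Real.exp (-2 * ε ^ 2 * n) := by
  have h := bernoulli_mgf_le (q := 1 - d) (by linarith) (by linarith) (4 * ε * s)
  rw [sub_sub_cancel] at h
  have h1 := pow_le_pow_left₀ (by have := Real.exp_pos (4 * ε * s); nlinarith) h n
  rw [add_pow, ← Real.exp_nat_mul] at h1
  have h2 := mul_le_mul_of_nonneg_right h1
    (Real.exp_pos (-(4 * ε * s * ((1 - d + s * ε) * n)))).le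
  rw [Finset.sum_mul, ← Real.exp_add] at h2
  refine le_trans (le_of_eq (Finset.sum_congr rfl fun k _ => ?_)) (h2.trans (le_of_eq ?_))
  · rw [mul_pow, ← Real.exp_nat_mul, mul_sub (4 * ε * s),
      sub_eq_add_neg (4 * ε * s * k), Real.exp_add, mul_comm (k : ℝ) (4 * ε * s)]
    ring
  · congr 1
    linear_combination (-2 * ε ^ 2 * n) * hs

lemma sum_binomial_mul_const (n : ℕ) (d a : ℝ) :
    ∑ k ∈ Finset.range (n + 1), ((1 - d) ^ k * d ^ (n - k) * n.choose k) * a = a := by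
  rw [← Finset.sum_mul, ← add_pow]
  simp

/-- For every `ε > 0`, every `d ∈ [ε, 1−ε]` and every `n ≥ 1`,
`C_{n,⌈(1−d−ε)n⌉} − 2e^{−2ε²n} ≤ C_n(d) ≤ C_{n,⌊(1−d+ε)n⌋} + 2e^{−2ε²n}`. -/
theorem Cn_between_Cnk (ε : ℝ) (hε : 0 < ε) (d : ℝ) (hd : d ∈ Set.Icc ε (1 - ε))
    (n : ℕ) (hn : 1 ≤ n) :
    Cnk n ⌈(1 - d - ε) * n⌉₊ - 2 * Real.exp (-2 * ε ^ 2 * n) ≤ Cn n d ∧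
    Cn n d ≤ Cnk n ⌊(1 - d + ε) * n⌋₊ + 2 * Real.exp (-2 * ε ^ 2 * n) := by
  obtain ⟨hd1, hd2⟩ := hd
  have hn0 : (0 : ℝ) < n := by exact_mod_cast hn
  have hE := Real.exp_pos (-2 * ε ^ 2 * n)
  have hb : ∀ k, 0 ≤ (1 - d) ^ k * d ^ (n - k) * (n.choose k : ℝ) := fun k =>
    mul_nonneg (mul_nonneg (pow_nonneg (by linarith) _) (pow_nonneg (by linarith) _))
      (Nat.cast_nonneg _)
  have hK : ⌊(1 - d + ε) * n⌋₊ ≤ n := Nat.floor_le_of_le (by nlinarith)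
  have hL : ⌈(1 - d - ε) * n⌉₊ ≤ n := Nat.ceil_le.2 (by nlinarith)
  have hupper : ∀ p : (Fin n → Bool) → ℝ, IsDist p → mutualInfo p (delW d) ≤
      mutualInfo p (exactW (n := n) (k := ⌊(1 - d + ε) * n⌋₊)) +
        n * Real.exp (-2 * ε ^ 2 * n) := by
    intro p hp
    rw [mutualInfo_delW]
    have h := mul_le_mul_of_nonneg_left (sum_binomial_mul_exp_le (d := d) (by linarith)
      (by linarith) n ε 1 (by norm_num)) hn0.le
    refine le_trans ?_ (add_le_add_right h _)
    rw [← sum_binomial_mul_const n d (mutualInfo p (exactW (k := ⌊(1 - d + ε) * n⌋₊))),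
      Finset.mul_sum, ← Finset.sum_add_distrib]
    refine Finset.sum_le_sum fun k hk => ?_
    have hkn : k ≤ n := Nat.lt_succ_iff.1 (Finset.mem_range.1 hk)
    rw [mul_left_comm (n : ℝ), ← mul_add]
    refine mul_le_mul_of_nonneg_left ?_ (hb k)
    rcases le_or_gt k ⌊(1 - d + ε) * n⌋₊ with hle | hgt
    · have := mutualInfo_exactW_mono hp hle hK
      have := mul_pos hn0 (Real.exp_pos (4 * ε * 1 * (k - (1 - d + 1 * ε) * n)))
      linarith
    · have h1 := Nat.lt_of_floor_lt hgt
      have h2 : 1 ≤ Real.exp (4 * ε * 1 * (k - (1 - d + 1 * ε) * n)) :=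
        Real.one_le_exp (mul_nonneg (by linarith) (by linarith))
      have h3 := mutualInfo_exactW_nonneg hp hK
      have h4 := mutualInfo_exactW_le hp hkn
      nlinarith
  have hlower : ∀ p : (Fin n → Bool) → ℝ, IsDist p →
      mutualInfo p (exactW (n := n) (k := ⌈(1 - d - ε) * n⌉₊)) ≤
        mutualInfo p (delW d) + n * Real.exp (-2 * ε ^ 2 * n) := by
    intro p hp
    rw [mutualInfo_delW]
    have h := mul_le_mul_of_nonneg_left (sum_binomial_mul_exp_le (d := d) (by linarith)
      (by linarith) n ε (-1) (by norm_num)) hn0.le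
    refine le_trans ?_ (add_le_add_right h _)
    rw [← sum_binomial_mul_const n d (mutualInfo p (exactW (k := ⌈(1 - d - ε) * n⌉₊))),
      Finset.mul_sum, ← Finset.sum_add_distrib]
    refine Finset.sum_le_sum fun k hk => ?_
    have hkn : k ≤ n := Nat.lt_succ_iff.1 (Finset.mem_range.1 hk)
    rw [mul_left_comm (n : ℝ), ← mul_add]
    refine mul_le_mul_of_nonneg_left ?_ (hb k)
    rcases le_or_gt ⌈(1 - d - ε) * n⌉₊ k with hle | hgt
    · have := mutualInfo_exactW_mono hp hle hkn
      have := mul_pos hn0 (Real.exp_pos (4 * ε * -1 * (k - (1 - d + -1 * ε) * n)))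
      linarith
    · have h1 := Nat.lt_ceil.1 hgt
      have h2 : 1 ≤ Real.exp (4 * ε * -1 * (k - (1 - d + -1 * ε) * n)) :=
        Real.one_le_exp (mul_nonneg_of_nonpos_of_nonpos (by linarith) (by linarith))
      have h3 := mutualInfo_exactW_nonneg hp hkn
      have h4 := mutualInfo_exactW_le hp hL
      nlinarith
  have hbddE : ∀ k ≤ n, BddAbove (Set.range fun p : {p : (Fin n → Bool) → ℝ // IsDist p} =>
      mutualInfo p.1 (exactW (n := n) (k := k))) := by
    rintro k hk
    exact ⟨n, by rintro _ ⟨p, rfl⟩; exact mutualInfo_exactW_le p.2 hk⟩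
  have hbddD : BddAbove (Set.range fun p : {p : (Fin n → Bool) → ℝ // IsDist p} =>
      mutualInfo p.1 (delW d)) :=
    ⟨n + n * Real.exp (-2 * ε ^ 2 * n), by
      rintro _ ⟨p, rfl⟩
      exact (hupper p.1 p.2).trans (by linarith [mutualInfo_exactW_le p.2 hK])⟩
  have : Nonempty {p : (Fin n → Bool) → ℝ // IsDist p} :=
    ⟨⟨Pi.single (fun _ => false) 1, fun a => (Pi.single_nonneg.2 zero_le_one : (0 : (Fin n → Bool) → ℝ) ≤ _) a, by simp⟩⟩
  have hscale : ∀ a b : ℝ, a ≤ b + n * Real.exp (-2 * ε ^ 2 * n) →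
      1 / (n : ℝ) * a ≤ 1 / (n : ℝ) * b + Real.exp (-2 * ε ^ 2 * n) := by
    intro a b hab
    have := mul_le_mul_of_nonneg_left hab (one_div_pos.2 hn0).le
    rwa [mul_add, ← mul_assoc _ (n : ℝ), one_div_mul_cancel hn0.ne', one_mul] at this
  constructor
  · have := hscale _ _ (ciSup_le fun p : {p : (Fin n → Bool) → ℝ // IsDist p} =>
      (hlower p.1 p.2).trans (add_le_add_left (le_ciSup hbddD p) _))
    unfold Cnk Cn
    linarith
  · have := hscale _ _ (ciSup_le fun p : {p : (Fin n → Bool) → ℝ // IsDist p} =>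
      (hupper p.1 p.2).trans (add_le_add_left (le_ciSup (hbddE _ hK) p) _))
    unfold Cnk Cn
    linarith
end
end
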